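/- arXiv:2509.03839 — 3 statements merged into one kernel-verified Lean document; each statement's English description precedes it below -/
import Mathlib

section
/- Let (X, 𝔉) be a measurable space, let q and p be probability measures on X with p absolutely continuous with respect to q, let λ > 0, and let S : X → ℝ be measurable. Assume exp(−S/λ) is q-integrable, S is p-integrable, and log(dp/dq) is p-integrable. Then −λ log ( ∫ exp(−S(x)/λ) dq(x) ) ≤ ∫ S(x) dp(x) + λ ∫ log((dp/dq)(x)) dp(x). -/
open MeasureTheory Real

/-- Free-energy lower bound via Jensen's inequality (Proposition 3 of the
paper, abstract form): for probability measures `p ≪ q`, `λ > 0` and measurable `S`,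
`−λ log ∫ exp(−S/λ) dq ≤ ∫ S dp + λ ∫ log(dp/dq) dp`. -/
theorem free_energy_lower_bound
    {X : Type*} [MeasurableSpace X] (q p : Measure X)
    [IsProbabilityMeasure q] [IsProbabilityMeasure p]
    (hac : p ≪ q) (lam : ℝ) (hlam : 0 < lam)
    (S : X → ℝ) (hS : Measurable S)
    (h1 : Integrable (fun x => Real.exp (-S x / lam)) q)
    (h2 : Integrable S p)
    (h3 : Integrable (fun x => Real.log ((p.rnDeriv q x).toReal)) p) :
    -lam * Real.log (∫ x, Real.exp (-S x / lam) ∂q) ≤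
      ∫ x, S x ∂p + lam * ∫ x, Real.log ((p.rnDeriv q x).toReal) ∂p := by
  have hf : Integrable (fun x => -S x / lam) p := h2.neg.div_const lam
  have hl : Integrable (llr p q) p := h3
  have : IsProbabilityMeasure (q.tilted fun x => -S x / lam) := isProbabilityMeasure_tilted h1
  have hac2 : p ≪ q.tilted fun x => -S x / lam := hac.trans (absolutelyContinuous_tilted h1)
  have hn := InformationTheory.integral_llr_add_sub_measure_univ_nonneg hac2
    (integrable_llr_tilted_right hac hf hl h1)
  rw [integral_llr_tilted_right hac hf h1 hl] at hn
  have e : ∫ x, -S x / lam ∂p = -(∫ x, S x ∂p) / lam := by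
    rw [integral_div, integral_neg]
  have e2 : ∫ x, llr p q x ∂p = ∫ x, Real.log ((p.rnDeriv q x).toReal) ∂p := rfl
  rw [e, e2] at hn
  simp only [probReal_univ] at hn
  have h4 := mul_nonneg hlam.le hn
  have h5 : lam * (-(∫ x, S x ∂p) / lam) = -(∫ x, S x ∂p) := by field_simp
  linarith
end

section
/- Let M, H ∈ ℕ, let Σ ∈ ℝ^{M×M} be symmetric positive definite, λ > 0, u_ref ∈ ℝ^M, and let u_0,…,u_{H−1} ∈ ℝ^M. Let (𝒲, 𝔊, ν) be a probability space and let S : (ℝ^M)^H × 𝒲 → ℝ be measurable. Define the probability measures q := (⊗_{τ=0}^{H−1} N(u_ref, Σ)) ⊗ ν and p_U := (⊗_{τ=0}^{H−1} N(u_τ, Σ)) ⊗ ν on (ℝ^M)^H × 𝒲, where N(μ, Σ) is the Gaussian measure on ℝ^M. Assume exp(−S/λ) is q-integrable and S is p_U-integrable. Then the free energy satisfies −λ log ( ∫ exp(−S/λ) dq ) ≤ ∫ S dp_U + (λ/2) Σ_{τ=0}^{H−1} (u_τ − u_ref)ᵀ Σ⁻¹ (u_τ − u_ref). -/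
open Matrix MeasureTheory Real BigOperators


open scoped MatrixOrder in
lemma exists_sq_factor {M : ℕ} {P : Matrix (Fin M) (Fin M) ℝ} (hP : P.PosDef) :
    ∃ B : Matrix (Fin M) (Fin M) ℝ, P = Bᵀ * B := by
  obtain ⟨B, hB⟩ := CStarAlgebra.nonneg_iff_eq_star_mul_self.mp hP.posSemidef.nonneg
  exact ⟨B, by rw [hB, Matrix.star_eq_conjTranspose, Matrix.conjTranspose_eq_transpose_of_trivial]⟩

lemma std_gauss_integral (M : ℕ) :
    ∫ w : Fin M → ℝ, Real.exp (-(1 / 2) * (w ⬝ᵥ w)) = (√(2 * π)) ^ M := by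
  have h : ∀ w : Fin M → ℝ, Real.exp (-(1 / 2) * (w ⬝ᵥ w))
      = ∏ i, Real.exp (-(1 / 2) * (w i) ^ 2) := by
    intro w
    rw [← Real.exp_sum, ← Finset.mul_sum]
    simp [dotProduct, sq]
  simp_rw [h]
  rw [integral_fintype_prod_volume_eq_pow (fun x : ℝ => Real.exp (-(1 / 2) * x ^ 2)),
    integral_gaussian]
  simp [mul_comm]

lemma gauss_integral {M : ℕ} {Sig : Matrix (Fin M) (Fin M) ℝ} (hSig : Sig.PosDef)
    (μ : Fin M → ℝ) :
    ∫ v : Fin M → ℝ, (((2 * Real.pi) • Sig).det) ^ (-(1 : ℝ) / 2) *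
        Real.exp (-(1 / 2) * ((v - μ) ⬝ᵥ Sig⁻¹.mulVec (v - μ))) = 1 := by
  obtain ⟨B, hB⟩ := exists_sq_factor hSig.inv
  have hdS := hSig.det_pos
  have hdet : B.det ^ 2 = Sig.det⁻¹ := by
    have := congrArg Matrix.det hB
    rw [Matrix.det_mul, Matrix.det_transpose, Matrix.det_nonsing_inv, Ring.inverse_eq_inv'] at this
    rw [this]; ring
  have hB0 : B.det ≠ 0 := by
    intro h
    rw [h] at hdet
    have : 0 < Sig.det⁻¹ := inv_pos.2 hdS
    simp at hdet
    linarith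
  rw [integral_const_mul,
    integral_sub_right_eq_self (fun v => Real.exp (-(1 / 2) * (v ⬝ᵥ Sig⁻¹.mulVec v))) μ]
  have hq : ∀ v : Fin M → ℝ, v ⬝ᵥ Sig⁻¹.mulVec v
      = (Matrix.toLin' B v) ⬝ᵥ (Matrix.toLin' B v) := by
    intro v
    rw [hB, ← Matrix.mulVec_mulVec, Matrix.toLin'_apply, Matrix.dotProduct_mulVec,
      Matrix.vecMul_transpose]
  simp_rw [hq]
  have hmap := Real.map_matrix_volume_pi_eq_smul_volume_pi hB0
  have hI : ∫ v : Fin M → ℝ, Real.exp (-(1 / 2) * ((Matrix.toLin' B v) ⬝ᵥ (Matrix.toLin' B v)))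
      = |B.det|⁻¹ * (√(2 * π)) ^ M := by
    rw [← std_gauss_integral, ← integral_map (φ := Matrix.toLin' B)
      (f := fun w : Fin M → ℝ => Real.exp (-(1 / 2) * (w ⬝ᵥ w))), hmap, integral_smul_measure,
      ENNReal.toReal_ofReal (abs_nonneg _), abs_inv, smul_eq_mul]
    · exact (LinearMap.continuous_of_finiteDimensional _).aemeasurable
    · apply Continuous.aestronglyMeasurable
      simp only [dotProduct]
      fun_prop
  rw [hI, Matrix.det_smul, Fintype.card_fin]
  have hb : |B.det| = √(Sig.det⁻¹) := by rw [← hdet, Real.sqrt_sq_eq_abs]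
  have h2 : ((2 * π) ^ M * Sig.det) ^ (-(1 : ℝ) / 2) = (√((2 * π) ^ M * Sig.det))⁻¹ := by
    rw [Real.sqrt_eq_rpow, ← Real.rpow_neg (by positivity)]; norm_num
  rw [h2, hb, Real.sqrt_mul (by positivity), Real.sqrt_inv]
  have h3 : √((2 * π) ^ M) = (√(2 * π)) ^ M := by
    rw [Real.sqrt_eq_iff_mul_self_eq (by positivity) (by positivity), ← mul_pow,
      Real.mul_self_sqrt (by positivity)]
  rw [h3]
  have : 0 < √Sig.det := Real.sqrt_pos.2 hdS
  have : 0 < √(2 * π) := Real.sqrt_pos.2 (by positivity)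
  field_simp

lemma quad_expand {M : ℕ} {P : Matrix (Fin M) (Fin M) ℝ} (hP : Pᵀ = P) (a d : Fin M → ℝ) :
    (a + d) ⬝ᵥ P.mulVec (a + d) = a ⬝ᵥ P.mulVec a + 2 * (d ⬝ᵥ P.mulVec a) + d ⬝ᵥ P.mulVec d := by
  have : a ⬝ᵥ P.mulVec d = d ⬝ᵥ P.mulVec a := by
    rw [Matrix.dotProduct_mulVec, ← Matrix.mulVec_transpose, hP, dotProduct_comm]
  simp only [Matrix.mulVec_add, dotProduct_add, add_dotProduct, this]
  ring

/-- Proposition 3 of the paper: with `q = (⊗_τ N(u_ref, Σ)) ⊗ ν` and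
`p_U = (⊗_τ N(u_τ, Σ)) ⊗ ν` (Gaussian product measures realized by their joint densities
with respect to Lebesgue measure), the free energy satisfies
`−λ log ∫ exp(−S/λ) dq ≤ ∫ S dp_U + (λ/2) Σ_τ (u_τ−u_ref)ᵀ Σ⁻¹ (u_τ−u_ref)`. -/
theorem mppi_free_energy_bound
    (M H : ℕ) (Sig : Matrix (Fin M) (Fin M) ℝ) (hSig : Sig.PosDef)
    (lam : ℝ) (hlam : 0 < lam) (uref : Fin M → ℝ) (u : Fin H → Fin M → ℝ)
    {W : Type*} [MeasurableSpace W] (ν : Measure W) [IsProbabilityMeasure ν]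
    (S : (Fin H → Fin M → ℝ) × W → ℝ) (hS : Measurable S)
    (f : (Fin M → ℝ) → (Fin M → ℝ) → ℝ)
    (hf : ∀ μ v, f μ v = (((2 * Real.pi) • Sig).det) ^ (-(1 : ℝ) / 2) *
        Real.exp (-(1 / 2) * ((v - μ) ⬝ᵥ Sig⁻¹.mulVec (v - μ))))
    (q pU : Measure ((Fin H → Fin M → ℝ) × W))
    (hq : q = ((volume : Measure (Fin H → Fin M → ℝ)).withDensity
        (fun V => ENNReal.ofReal (∏ τ : Fin H, f uref (V τ)))).prod ν)
    (hpU : pU = ((volume : Measure (Fin H → Fin M → ℝ)).withDensity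
        (fun V => ENNReal.ofReal (∏ τ : Fin H, f (u τ) (V τ)))).prod ν)
    (h1 : Integrable (fun z => Real.exp (-S z / lam)) q)
    (h2 : Integrable S pU) :
    -lam * Real.log (∫ z, Real.exp (-S z / lam) ∂q) ≤
      ∫ z, S z ∂pU +
        (lam / 2) * ∑ τ : Fin H, ((u τ - uref) ⬝ᵥ Sig⁻¹.mulVec (u τ - uref)) := by
  set P := Sig⁻¹ with hPdef
  have hPs : Pᵀ = P := by
    have := hSig.inv.isHermitian
    rwa [Matrix.IsHermitian, Matrix.conjTranspose_eq_transpose_of_trivial] at this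
  set G : (Fin H → Fin M → ℝ) → (Fin H → Fin M → ℝ) → ℝ := fun w V => ∏ τ, f (w τ) (V τ) with hG
  have hdet : 0 < (((2 * Real.pi) • Sig).det) ^ (-(1 : ℝ) / 2) := by
    apply Real.rpow_pos_of_pos
    rw [Matrix.det_smul]
    have := hSig.det_pos
    positivity
  have hGpos : ∀ w V, 0 < G w V := fun w V =>
    Finset.prod_pos fun τ _ => by rw [hf]; positivity
  have hGcont : ∀ w, Continuous (G w) := by
    intro w
    simp only [hG, hf, dotProduct, Matrix.mulVec]
    fun_prop
  have hGint1 : ∀ w, ∫ V, G w V = 1 := by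
    intro w
    simp only [hG]
    rw [integral_fintype_prod_volume_eq_prod (fun τ v => f (w τ) v)]
    refine Finset.prod_eq_one fun τ _ => ?_
    simp_rw [hf]
    exact gauss_integral hSig (w τ)
  have hGint : ∀ w, Integrable (G w) := fun w => by
    by_contra h
    have := hGint1 w
    rw [integral_undef h] at this
    norm_num at this
  set L : (Fin H → Fin M → ℝ) → (Fin H → Fin M → ℝ) → ℝ :=
    fun d V => ∑ τ, d τ ⬝ᵥ P.mulVec (V τ - u τ) with hL
  set c : (Fin H → Fin M → ℝ) → ℝ := fun d => (1 / 2) * ∑ τ, d τ ⬝ᵥ P.mulVec (d τ) with hc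
  have hLcont : ∀ d, Continuous (L d) := by
    intro d
    simp only [hL, dotProduct, Matrix.mulVec]
    fun_prop
  have hkey : ∀ d V, G (u - d) V = G u V * Real.exp (-L d V - c d) := by
    intro d V
    simp only [hG, hL, hc]
    rw [Finset.mul_sum, ← Finset.sum_neg_distrib, ← Finset.sum_sub_distrib, Real.exp_sum,
      ← Finset.prod_mul_distrib]
    refine Finset.prod_congr rfl fun τ _ => ?_
    rw [hf, hf, mul_assoc, ← Real.exp_add]
    have e : V τ - (u - d) τ = (V τ - u τ) + d τ := by simp only [Pi.sub_apply]; abel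
    rw [e, quad_expand hPs]
    congr 2
    ring
  have hexpint : ∀ d, Integrable (fun V => G u V * Real.exp (-L d V)) := by
    intro d
    refine ((hGint (u - d)).mul_const (Real.exp (c d))).congr (Filter.Eventually.of_forall ?_)
    intro V
    simp only [hkey, mul_assoc, ← Real.exp_add]
    congr 2
    ring
  have hLneg : ∀ d V, L (-d) V = -L d V := by
    intro d V
    simp [hL]
  have hLint : ∀ d, Integrable (fun V => G u V * L d V) := by
    intro d
    refine ((hexpint d).add (hexpint (-d))).mono'
      ((hGcont u).mul (hLcont d)).aestronglyMeasurable (Filter.Eventually.of_forall fun V => ?_)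
    simp only [Pi.add_apply, hLneg, neg_neg, Real.norm_eq_abs, abs_mul, abs_of_pos (hGpos u V)]
    rw [← mul_add]
    refine mul_le_mul_of_nonneg_left ?_ (hGpos u V).le
    have a1 := Real.add_one_le_exp (L d V)
    have a2 := Real.add_one_le_exp (-L d V)
    have a3 := Real.exp_pos (L d V)
    have a4 := Real.exp_pos (-L d V)
    rw [abs_le]; constructor <;> linarith
  have hL0 : ∀ d, ∫ V, G u V * L d V = 0 := by
    intro d
    have h := integral_sub_left_eq_self (fun V => G u V * L d V) volume (u + u)
    have hr : ∀ V, G u (u + u - V) * L d (u + u - V) = -(G u V * L d V) := by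
      intro V
      have e : ∀ τ, (u + u - V) τ - u τ = -(V τ - u τ) := by
        intro τ; simp only [Pi.sub_apply, Pi.add_apply]; abel
      have e1 : G u (u + u - V) = G u V := by
        simp only [hG, hf, e]
        simp [Matrix.mulVec_neg, -neg_sub]
      have e2 : L d (u + u - V) = - L d V := by
        simp only [hL, e]
        simp [Matrix.mulVec_neg, -neg_sub]
      rw [e1, e2]; ring
    simp_rw [hr] at h
    rw [integral_neg] at h
    linarith
  set Q : Measure (Fin H → Fin M → ℝ) := volume.withDensity (fun V => ENNReal.ofReal (G u V))
    with hQ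
  have hGm : ∀ w, Measurable fun V => ENNReal.ofReal (G w V) := fun w =>
    (hGcont w).measurable.ennreal_ofReal
  have hQp : IsProbabilityMeasure Q := by
    constructor
    rw [hQ, withDensity_apply _ MeasurableSet.univ, Measure.restrict_univ,
      ← ofReal_integral_eq_lintegral_ofReal (hGint u)
        (Filter.Eventually.of_forall fun V => (hGpos u V).le), hGint1, ENNReal.ofReal_one]
  have hpU' : pU = Q.prod ν := hpU
  have : IsProbabilityMeasure pU := by rw [hpU']; infer_instance
  set d : Fin H → Fin M → ℝ := fun τ => u τ - uref with hd
  have hud : u - d = fun _ => uref := by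
    funext τ; simp [hd]
  set r : (Fin H → Fin M → ℝ) → ℝ := fun V => -L d V - c d with hr
  have hrcont : Continuous r := ((hLcont d).neg).sub continuous_const
  have hrm : Measurable fun V => ENNReal.ofReal (Real.exp (r V)) :=
    (Real.continuous_exp.comp hrcont).measurable.ennreal_ofReal
  have hqd : q = pU.withDensity (fun z => ENNReal.ofReal (Real.exp (r z.1))) := by
    have e : (fun V : Fin H → Fin M → ℝ => ENNReal.ofReal (∏ τ : Fin H, f uref (V τ)))
        = (fun V => ENNReal.ofReal (G u V)) * (fun V => ENNReal.ofReal (Real.exp (r V))) := by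
      funext V
      have := hkey d V
      rw [hud] at this
      rw [Pi.mul_apply, ← ENNReal.ofReal_mul (hGpos u V).le, ← this]
    rw [hq, e, withDensity_mul _ (hGm u) hrm, hpU', prod_withDensity_left hrm]
  have hrm' : Measurable fun z : (Fin H → Fin M → ℝ) × W => ENNReal.ofReal (Real.exp (r z.1)) :=
    hrm.comp measurable_fst
  have hLQ : Integrable (L d) Q := by
    rw [hQ, integrable_withDensity_iff_integrable_smul' (hGm u) (by simp)]
    simpa [ENNReal.toReal_ofReal (hGpos u _).le] using hLint d
  have hLQ0 : ∫ V, L d V ∂Q = 0 := by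
    rw [hQ, integral_withDensity_eq_integral_toReal_smul (hGm u) (by simp)]
    simpa [ENNReal.toReal_ofReal (hGpos u _).le] using hL0 d
  have hrQ : Integrable r Q := hLQ.neg.sub (integrable_const _)
  have hrQ' : ∫ V, r V ∂Q = - c d := by
    simp only [hr]
    rw [integral_sub (f := fun V => -L d V) hLQ.neg (integrable_const _), integral_neg, hLQ0]
    simp
  have hrp : Integrable (fun z : (Fin H → Fin M → ℝ) × W => r z.1) pU := by
    rw [hpU']; exact hrQ.comp_fst ν
  have hrp' : ∫ z, r z.1 ∂pU = - c d := by
    rw [hpU', integral_fun_fst, hrQ']; simp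
  have hexp : ∀ z : (Fin H → Fin M → ℝ) × W,
      (ENNReal.ofReal (Real.exp (r z.1))).toReal • Real.exp (-S z / lam)
        = Real.exp (r z.1 + -S z / lam) := by
    intro z
    rw [ENNReal.toReal_ofReal (Real.exp_pos _).le, smul_eq_mul, Real.exp_add]
  have hSl : Integrable (fun z => -S z / lam) pU := h2.neg.div_const lam
  have hJ := ConvexOn.map_integral_le (μ := pU) (s := Set.univ) (g := Real.exp)
    (f := fun z => r z.1 + -S z / lam) convexOn_exp Real.continuous_exp.continuousOn isClosed_univ
    (by simp) (hrp.add hSl) (by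
      rw [hqd, integrable_withDensity_iff_integrable_smul' hrm' (by simp)] at h1
      simp_rw [hexp] at h1
      exact h1)
  have hI : ∫ z, Real.exp (-S z / lam) ∂q = ∫ z, Real.exp (r z.1 + -S z / lam) ∂pU := by
    rw [hqd, integral_withDensity_eq_integral_toReal_smul hrm' (by simp)]
    simp_rw [hexp]
  rw [← hI, integral_add hrp hSl, hrp', integral_div, integral_neg] at hJ
  have hlog := (Real.le_log_iff_exp_le ((Real.exp_pos _).trans_le hJ)).2 hJ
  have hm := mul_le_mul_of_nonneg_left hlog hlam.le
  have e : lam * (-c d + -(∫ z, S z ∂pU) / lam) = -(lam * c d) - ∫ z, S z ∂pU := by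
    field_simp
    ring
  rw [e] at hm
  have ec : lam * c d = (lam / 2) * ∑ τ : Fin H, ((u τ - uref) ⬝ᵥ P.mulVec (u τ - uref)) := by
    simp only [hc, hd]; ring
  rw [← ec]
  linarith
end

section
/- Let M, H ∈ ℕ, let Σ ∈ ℝ^{M×M} be symmetric positive definite, λ > 0, u_ref ∈ ℝ^M, and û_0,…,û_{H−1} ∈ ℝ^M. Let (𝒲, 𝔊, ν) be a probability space and S : (ℝ^M)^H × 𝒲 → ℝ measurable. Define q := (⊗_{τ=0}^{H−1} N(u_ref, Σ)) ⊗ ν and p_Û := (⊗_{τ=0}^{H−1} N(û_τ, Σ)) ⊗ ν on X := (ℝ^M)^H × 𝒲, assume η := ∫ exp(−S/λ) dq ∈ (0,∞), and define the optimal distribution p* by dp* := η⁻¹ exp(−S/λ) dq, and the importance weight w(V, W) := exp(−(1/λ) S(V, W) − Σ_{τ=0}^{H−1} (û_τ − u_ref)ᵀ Σ⁻¹ (v_τ − u_ref)). Set η̃ := ∫ w dp_Û. If for a fixed τ ∈ {0,…,H−1} the coordinate map V ↦ v_τ is p*-integrable and (V,W) ↦ w(V,W) v_τ is p_Û-integrable,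 then ∫ v_τ dp* = η̃⁻¹ ∫ w(V, W) v_τ dp_Û, componentwise in ℝ^M. -/
open Matrix MeasureTheory Real BigOperators

/-- Importance-sampling identity at the core of Proposition 5 of the
paper: the mean of the coordinate `v_τ` under the optimal distribution
`dp* = η⁻¹ exp(−S/λ) dq` equals the `w`-weighted mean under the sampling distribution
`p_Û`: `∫ v_τ dp* = η̃⁻¹ ∫ w(V,W) v_τ dp_Û` (componentwise), with `η̃ = ∫ w dp_Û`. -/
theorem importance_sampling_identity
    (M H : ℕ) (Sig : Matrix (Fin M) (Fin M) ℝ) (hSig : Sig.PosDef)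
    (lam : ℝ) (hlam : 0 < lam) (uref : Fin M → ℝ) (uhat : Fin H → Fin M → ℝ)
    {W : Type*} [MeasurableSpace W] (ν : Measure W) [IsProbabilityMeasure ν]
    (S : (Fin H → Fin M → ℝ) × W → ℝ) (hS : Measurable S)
    (f : (Fin M → ℝ) → (Fin M → ℝ) → ℝ)
    (hf : ∀ μ v, f μ v = (((2 * Real.pi) • Sig).det) ^ (-(1 : ℝ) / 2) *
        Real.exp (-(1 / 2) * ((v - μ) ⬝ᵥ Sig⁻¹.mulVec (v - μ))))
    (q pU : Measure ((Fin H → Fin M → ℝ) × W))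
    (hq : q = ((volume : Measure (Fin H → Fin M → ℝ)).withDensity
        (fun V => ENNReal.ofReal (∏ τ : Fin H, f uref (V τ)))).prod ν)
    (hpU : pU = ((volume : Measure (Fin H → Fin M → ℝ)).withDensity
        (fun V => ENNReal.ofReal (∏ τ : Fin H, f (uhat τ) (V τ)))).prod ν)
    (hexpint : Integrable (fun z => Real.exp (-S z / lam)) q)
    (η : ℝ) (hη : η = ∫ z, Real.exp (-S z / lam) ∂q) (hη0 : 0 < η)
    (pstar : Measure ((Fin H → Fin M → ℝ) × W))
    (hpstar : pstar = q.withDensity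
        (fun z => ENNReal.ofReal (η⁻¹ * Real.exp (-S z / lam))))
    (w : (Fin H → Fin M → ℝ) × W → ℝ)
    (hw : ∀ V Wp, w (V, Wp) = Real.exp (-S (V, Wp) / lam -
        ∑ τ : Fin H, ((uhat τ - uref) ⬝ᵥ Sig⁻¹.mulVec (V τ - uref))))
    (ηt : ℝ) (hηt : ηt = ∫ z, w z ∂pU)
    (τ : Fin H)
    (hint_star : ∀ i, Integrable (fun z => z.1 τ i) pstar)
    (hint_w : ∀ i, Integrable (fun z => w z * z.1 τ i) pU) :
    ∀ i : Fin M, ∫ z, z.1 τ i ∂pstar = ηt⁻¹ * ∫ z, w z * z.1 τ i ∂pU := by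
  have hsymm : Sig⁻¹ᵀ = Sig⁻¹ := by
    have h := hSig.inv.isHermitian
    rw [Matrix.IsHermitian, Matrix.conjTranspose_eq_transpose_of_trivial] at h
    exact h
  have hdet : 0 ≤ (((2 * Real.pi) • Sig).det) ^ (-(1 : ℝ) / 2) := by
    apply Real.rpow_nonneg
    have : ((2 * Real.pi) • Sig).PosDef := hSig.smul (by positivity)
    exact this.det_pos.le
  have hfnn : ∀ μ v, 0 ≤ f μ v := fun μ v => by
    rw [hf]; exact mul_nonneg hdet (Real.exp_pos _).le
  have hfm : ∀ μ, Measurable (f μ) := fun μ => by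
    have : f μ = fun v => (((2 * Real.pi) • Sig).det) ^ (-(1 : ℝ) / 2) *
        Real.exp (-(1 / 2) * ((v - μ) ⬝ᵥ Sig⁻¹.mulVec (v - μ))) := funext (hf μ)
    rw [this]
    simp only [dotProduct, Matrix.mulVec, Pi.sub_apply]
    fun_prop
  have key : ∀ (u : Fin H → Fin M → ℝ) (g : (Fin H → Fin M → ℝ) × W → ℝ),
      ∫ z, g z ∂(((volume : Measure (Fin H → Fin M → ℝ)).withDensity
        (fun V => ENNReal.ofReal (∏ τ : Fin H, f (u τ) (V τ)))).prod ν) =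
      ∫ z, (∏ τ : Fin H, f (u τ) (z.1 τ)) * g z
        ∂((volume : Measure (Fin H → Fin M → ℝ)).prod ν) := by
    intro u g
    have hm : Measurable (fun V : Fin H → Fin M → ℝ => ∏ τ : Fin H, f (u τ) (V τ)) :=
      Finset.measurable_prod _ (fun t _ => (hfm (u t)).comp (measurable_pi_apply t))
    rw [prod_withDensity_left (by fun_prop),
      integral_withDensity_eq_integral_toReal_smul (by fun_prop)
        (Filter.Eventually.of_forall fun _ => ENNReal.ofReal_lt_top)]
    refine integral_congr_ae (Filter.Eventually.of_forall fun z => ?_)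
    simp only [smul_eq_mul]
    rw [ENNReal.toReal_ofReal (Finset.prod_nonneg fun t _ => hfnn _ _)]
  let c : Fin H → ℝ := fun t =>
    Real.exp (-(1 / 2) * ((uhat t - uref) ⬝ᵥ Sig⁻¹.mulVec (uhat t - uref)))
  have hpt : ∀ (t : Fin H) (v : Fin M → ℝ),
      f (uhat t) v * Real.exp (-((uhat t - uref) ⬝ᵥ Sig⁻¹.mulVec (v - uref)))
        = c t * f uref v := by
    intro t v
    have hs : (v - uref) ⬝ᵥ Sig⁻¹.mulVec (uhat t - uref)
        = (uhat t - uref) ⬝ᵥ Sig⁻¹.mulVec (v - uref) := by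
      rw [Matrix.dotProduct_mulVec, ← Matrix.mulVec_transpose, hsymm, dotProduct_comm]
    have hd : v - uhat t = (v - uref) - (uhat t - uref) := by abel
    simp only [hf, c]
    rw [hd, Matrix.mulVec_sub, dotProduct_sub, sub_dotProduct (v - uref) (uhat t - uref),
      sub_dotProduct (v - uref) (uhat t - uref), hs,
      mul_assoc, ← Real.exp_add, mul_left_comm, ← Real.exp_add]
    congr 2
    ring
  have hprod : ∀ z : (Fin H → Fin M → ℝ) × W,
      (∏ t : Fin H, f (uhat t) (z.1 t)) * w z
        = (∏ t, c t) * ((∏ t : Fin H, f uref (z.1 t)) * Real.exp (-S z / lam)) := by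
    rintro ⟨V, x⟩
    have h : (∏ t : Fin H, f (uhat t) (V t)) *
        Real.exp (-∑ t : Fin H, ((uhat t - uref) ⬝ᵥ Sig⁻¹.mulVec (V t - uref)))
        = (∏ t, c t) * ∏ t : Fin H, f uref (V t) := by
      rw [← Finset.sum_neg_distrib, Real.exp_sum, ← Finset.prod_mul_distrib,
        ← Finset.prod_mul_distrib]
      exact Finset.prod_congr rfl fun t _ => hpt t (V t)
    rw [hw, sub_eq_add_neg, Real.exp_add]
    simp only
    linear_combination Real.exp (-S (V, x) / lam) * h
  have main : ∀ g : (Fin H → Fin M → ℝ) × W → ℝ,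
      ∫ z, w z * g z ∂pU = (∏ t, c t) * ∫ z, Real.exp (-S z / lam) * g z ∂q := by
    intro g
    rw [hpU, hq, key uhat, key (fun _ => uref), ← integral_const_mul]
    refine integral_congr_ae (Filter.Eventually.of_forall fun z => ?_)
    simp only
    rw [← mul_assoc, hprod]
    ring
  have hC : (∏ t, c t) ≠ 0 := Finset.prod_ne_zero_iff.mpr fun t _ => (Real.exp_pos _).ne'
  have hηt' : ηt = (∏ t, c t) * η := by
    have := main (fun _ => 1)
    simp only [mul_one] at this
    rw [hηt, this, hη]
  intro i
  rw [main (fun z => z.1 τ i), hpstar,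
    integral_withDensity_eq_integral_toReal_smul (by fun_prop)
      (Filter.Eventually.of_forall fun _ => ENNReal.ofReal_lt_top), hηt']
  have : ∫ z, (ENNReal.ofReal (η⁻¹ * Real.exp (-S z / lam))).toReal • z.1 τ i ∂q
      = η⁻¹ * ∫ z, Real.exp (-S z / lam) * z.1 τ i ∂q := by
    rw [← integral_const_mul]
    refine integral_congr_ae (Filter.Eventually.of_forall fun z => ?_)
    simp only [smul_eq_mul]
    rw [ENNReal.toReal_ofReal (by positivity), mul_assoc]
  rw [this]
  have := hη0.ne'
  field_simp
end
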